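/- The integrand \widehat{B_♯}(A) = ½(|A|²/det A + log(|A|²/(det A)²)), defined on the set ℝ^{2×2}_+ of 2×2 matrices with positive determinant, is polyconvex: there exists a convex function G : ℝ^{2×2} × (0,∞) → ℝ such that \widehat{B_♯}(A) = G(A, det A) for every A ∈ ℝ^{2×2} with det A > 0. -/

import Mathlib

open Matrix MeasureTheory Set

/-- The operator norm `|A| = max_{|ξ|=1} |Aξ|` of a square matrix, computed via the
Euclidean spaces. -/
noncomputable def opNorm {n : ℕ} (A : Matrix (Fin n) (Fin n) ℝ) : ℝ :=
  ‖LinearMap.toContinuousLinearMap (Matrix.toEuclideanLin A)‖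

/-- `F` is rank-one convex: `t ↦ F (A + t • X)` is convex whenever `rank X = 1`. -/
def RankOneConvex {n : ℕ} (F : Matrix (Fin n) (Fin n) ℝ → ℝ) : Prop :=
  ∀ A X : Matrix (Fin n) (Fin n) ℝ, X.rank = 1 →
    ConvexOn ℝ Set.univ (fun t : ℝ => F (A + t • X))

/-- `F` is isotropic: `F (Q * A * R) = F A` for all `Q, R ∈ SO(n)`. -/
def Isotropic {n : ℕ} (F : Matrix (Fin n) (Fin n) ℝ → ℝ) : Prop :=
  ∀ (A Q R : Matrix (Fin n) (Fin n) ℝ),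
    Qᵀ * Q = 1 → Q.det = 1 → Rᵀ * R = 1 → R.det = 1 → F (Q * A * R) = F A

/-- `F` is positively `p`-homogeneous: `F (t • A) = t ^ p * F A` for `t > 0`. -/
def PosHomogeneous {n : ℕ} (p : ℝ) (F : Matrix (Fin n) (Fin n) ℝ → ℝ) : Prop :=
  ∀ (A : Matrix (Fin n) (Fin n) ℝ) (t : ℝ), 0 < t → F (t • A) = t ^ p * F A

/-- The set `CO(n) = {t • Q : Q ∈ O(n), t ∈ ℝ}` of conformal matrices. -/
def ConformalSet (n : ℕ) : Set (Matrix (Fin n) (Fin n) ℝ) :=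
  {A | ∃ (t : ℝ) (Q : Matrix (Fin n) (Fin n) ℝ), Qᵀ * Q = 1 ∧ A = t • Q}

/-- The matrix `Īd = diag(1, …, 1, -1)`. -/
noncomputable def Ibar (n : ℕ) : Matrix (Fin n) (Fin n) ℝ :=
  Matrix.diagonal (fun i => if (i : ℕ) = n - 1 then -1 else 1)

/-- The norm of the anticonformal part of a `2 × 2` matrix; it is the difference of
the singular values when the determinant is nonnegative. -/
noncomputable def anticonformalNorm (A : Matrix (Fin 2) (Fin 2) ℝ) : ℝ :=
  ‖(⟨A 0 0 - A 1 1, A 0 1 + A 1 0⟩ : ℂ)‖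

/-- The norm of the conformal part of a `2 × 2` matrix; it is the sum of the singular values when
the determinant is nonnegative. -/
noncomputable def conformalNorm (A : Matrix (Fin 2) (Fin 2) ℝ) : ℝ :=
  ‖(⟨A 0 0 + A 1 1, A 0 1 - A 1 0⟩ : ℂ)‖

lemma anticonformalNorm_sq (A : Matrix (Fin 2) (Fin 2) ℝ) :
    anticonformalNorm A ^ 2 = (A 0 0 - A 1 1) ^ 2 + (A 0 1 + A 1 0) ^ 2 := by
  rw [anticonformalNorm, Complex.sq_norm, Complex.normSq_apply]
  ring

lemma conformalNorm_sq (A : Matrix (Fin 2) (Fin 2) ℝ) :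
    conformalNorm A ^ 2 = (A 0 0 + A 1 1) ^ 2 + (A 0 1 - A 1 0) ^ 2 := by
  rw [conformalNorm, Complex.sq_norm, Complex.normSq_apply]
  ring

lemma conformalNorm_sq_sub_anticonformalNorm_sq (A : Matrix (Fin 2) (Fin 2) ℝ) :
    conformalNorm A ^ 2 - anticonformalNorm A ^ 2 = 4 * A.det := by
  rw [anticonformalNorm_sq, conformalNorm_sq, Matrix.det_fin_two]
  ring

lemma convexOn_anticonformalNorm : ConvexOn ℝ Set.univ anticonformalNorm := by
  refine ⟨convex_univ, fun A _ B _ a b ha hb _ => ?_⟩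
  have key : (⟨(a • A + b • B) 0 0 - (a • A + b • B) 1 1,
      (a • A + b • B) 0 1 + (a • A + b • B) 1 0⟩ : ℂ) =
      a • (⟨A 0 0 - A 1 1, A 0 1 + A 1 0⟩ : ℂ) + b • (⟨B 0 0 - B 1 1, B 0 1 + B 1 0⟩ : ℂ) := by
    apply Complex.ext <;> simp <;> ring
  rw [anticonformalNorm, key]
  refine (norm_add_le _ _).trans_eq ?_
  rw [norm_smul, norm_smul, Real.norm_of_nonneg ha, Real.norm_of_nonneg hb]
  rfl

lemma norm_sq_toEuclideanLin_fin_two (A : Matrix (Fin 2) (Fin 2) ℝ)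
    (ξ : EuclideanSpace ℝ (Fin 2)) :
    ‖LinearMap.toContinuousLinearMap (Matrix.toEuclideanLin A) ξ‖ ^ 2 =
      (A 0 0 * ξ 0 + A 0 1 * ξ 1) ^ 2 + (A 1 0 * ξ 0 + A 1 1 * ξ 1) ^ 2 := by
  simp [EuclideanSpace.norm_sq_eq, Fin.sum_univ_two, Matrix.toEuclideanLin, Matrix.mulVec,
    dotProduct]

/-- A singular `2 × 2` quadratic form of nonnegative trace is positive semidefinite. -/
lemma quadratic_form_nonneg_of_det_eq_zero {p q r : ℝ} (htr : 0 ≤ p + r) (hdet : p * r = q ^ 2)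
    (u v : ℝ) : 0 ≤ p * u ^ 2 + 2 * q * (u * v) + r * v ^ 2 := by
  rcases htr.eq_or_lt with h | h
  · have hr : r = -p := by linarith
    subst hr
    have hp : p = 0 := by nlinarith [sq_nonneg p, sq_nonneg q]
    have hq : q = 0 := by nlinarith [sq_nonneg p, sq_nonneg q]
    simp [hp, hq]
  · have key : (p + r) * (p * u ^ 2 + 2 * q * (u * v) + r * v ^ 2) =
        (p * u + q * v) ^ 2 + (q * u + r * v) ^ 2 := by
      linear_combination (u ^ 2 + v ^ 2) * hdet
    exact nonneg_of_mul_nonneg_right (key ▸ by positivity) h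

/-- A singular `2 × 2` quadratic form has a nontrivial zero. -/
lemma exists_quadratic_form_eq_zero_of_det_eq_zero {p q r : ℝ} (hdet : p * r = q ^ 2) :
    ∃ u v : ℝ, 0 < u ^ 2 + v ^ 2 ∧ p * u ^ 2 + 2 * q * (u * v) + r * v ^ 2 = 0 := by
  by_cases hp : p = 0
  · exact ⟨1, 0, by norm_num, by simp [hp]⟩
  · exact ⟨q, -p, by rw [neg_sq]; positivity, by linear_combination p * hdet⟩

lemma opNorm_eq_of_det_eq_zero {A : Matrix (Fin 2) (Fin 2) ℝ} {x : ℝ} (hx : 0 ≤ x)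
    (htr : 0 ≤ (x ^ 2 - A 0 0 ^ 2 - A 1 0 ^ 2) + (x ^ 2 - A 0 1 ^ 2 - A 1 1 ^ 2))
    (hdet : (x ^ 2 - A 0 0 ^ 2 - A 1 0 ^ 2) * (x ^ 2 - A 0 1 ^ 2 - A 1 1 ^ 2) =
      (-(A 0 0 * A 0 1 + A 1 0 * A 1 1)) ^ 2) :
    opNorm A = x := by
  apply le_antisymm
  · refine ContinuousLinearMap.opNorm_le_bound _ hx fun ξ => ?_
    refine le_of_sq_le_sq ?_ (by positivity)
    rw [norm_sq_toEuclideanLin_fin_two, mul_pow, EuclideanSpace.norm_sq_eq, Fin.sum_univ_two,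
      Real.norm_eq_abs, Real.norm_eq_abs, sq_abs, sq_abs]
    linarith [quadratic_form_nonneg_of_det_eq_zero htr hdet (ξ 0) (ξ 1)]
  · obtain ⟨u, v, huv, h⟩ := exists_quadratic_form_eq_zero_of_det_eq_zero hdet
    have hξ : ‖!₂[u, v]‖ ^ 2 = u ^ 2 + v ^ 2 := by
      simp [EuclideanSpace.norm_sq_eq, Fin.sum_univ_two]
    have hpos : 0 < ‖!₂[u, v]‖ :=
      (norm_nonneg _).lt_of_ne fun h0 => by rw [← h0] at hξ; linarith
    have hA : ‖LinearMap.toContinuousLinearMap (Matrix.toEuclideanLin A) !₂[u, v]‖ ^ 2 =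
        (x * ‖!₂[u, v]‖) ^ 2 := by
      rw [norm_sq_toEuclideanLin_fin_two, mul_pow, hξ]
      simp only [Matrix.cons_val_zero, Matrix.cons_val_one]
      linarith
    have hA' := (sq_eq_sq₀ (norm_nonneg _) (by positivity)).1 hA
    exact le_of_mul_le_mul_right (hA' ▸ ContinuousLinearMap.le_opNorm _ _) hpos

lemma opNorm_fin_two (A : Matrix (Fin 2) (Fin 2) ℝ) :
    opNorm A = (conformalNorm A + anticonformalNorm A) / 2 := by
  have hσ : 0 ≤ conformalNorm A := norm_nonneg _
  have hβ : 0 ≤ anticonformalNorm A := norm_nonneg _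
  have hσ2 := conformalNorm_sq A
  have hβ2 := anticonformalNorm_sq A
  set σ := conformalNorm A
  set β := anticonformalNorm A
  have hx : ((σ + β) / 2) ^ 2 =
      (A 0 0 ^ 2 + A 0 1 ^ 2 + A 1 0 ^ 2 + A 1 1 ^ 2 + σ * β) / 2 := by
    linear_combination hσ2 / 4 + hβ2 / 4
  have hσβ : (σ * β) ^ 2 = ((A 0 0 + A 1 1) ^ 2 + (A 0 1 - A 1 0) ^ 2) *
      ((A 0 0 - A 1 1) ^ 2 + (A 0 1 + A 1 0) ^ 2) := by
    rw [mul_pow, hσ2, hβ2]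
  refine opNorm_eq_of_det_eq_zero (by positivity) ?_ ?_
  · rw [hx]
    linarith [mul_nonneg hσ hβ]
  · rw [hx]
    linear_combination hσβ / 4

/-- The affine (in `(β, δ)`) minorants whose supremum over `t > 0` is the polyconvex
representative. -/
noncomputable def minorant (β δ t : ℝ) : ℝ :=
  β * t - δ * t ^ 2 / 2 + 1 + Real.log t

/-- The maximiser of `minorant β δ` on `(0, ∞)`. -/
noncomputable def minorantArgmax (β δ : ℝ) : ℝ :=
  (β + √(β ^ 2 + 4 * δ)) / (2 * δ)

lemma minorantArgmax_pos {β δ : ℝ} (hβ : 0 ≤ β) (hδ : 0 < δ) : 0 < minorantArgmax β δ := by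
  unfold minorantArgmax
  positivity

lemma minorantArgmax_spec {β δ : ℝ} (hδ : 0 < δ) :
    δ * minorantArgmax β δ ^ 2 = β * minorantArgmax β δ + 1 := by
  have h : √(β ^ 2 + 4 * δ) ^ 2 = β ^ 2 + 4 * δ := Real.sq_sqrt (by positivity)
  unfold minorantArgmax
  generalize √(β ^ 2 + 4 * δ) = w at h ⊢
  field_simp
  linear_combination h

lemma minorant_le_of_critical {β δ s t : ℝ} (hδ : 0 < δ) (hs : 0 < s) (ht : 0 < t)
    (hcrit : δ * t ^ 2 = β * t + 1) : minorant β δ s ≤ minorant β δ t := by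
  have hlog : Real.log s - Real.log t ≤ s / t - 1 := by
    rw [← Real.log_div hs.ne' ht.ne']
    exact Real.log_le_sub_one_of_pos (by positivity)
  have hinv : s / t - 1 = (s - t) * (δ * t - β) := by
    field_simp
    linear_combination (t - s) * hcrit
  unfold minorant
  nlinarith [mul_nonneg hδ.le (sq_nonneg (s - t))]

lemma convexOn_minorant_anticonformalNorm {t : ℝ} (ht : 0 ≤ t) :
    ConvexOn ℝ ((Set.univ : Set (Matrix (Fin 2) (Fin 2) ℝ)) ×ˢ Set.Ioi (0 : ℝ))
      (fun P => minorant (anticonformalNorm P.1) P.2 t) := by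
  refine ⟨convex_univ.prod (convex_Ioi 0), fun P _ Q _ a b ha hb hab => ?_⟩
  have h := mul_le_mul_of_nonneg_right
    (convexOn_anticonformalNorm.2 (mem_univ P.1) (mem_univ Q.1) ha hb hab) ht
  simp only [minorant, Prod.fst_add, Prod.snd_add, Prod.smul_fst, Prod.smul_snd,
    smul_eq_mul] at h ⊢
  linear_combination h - (1 + Real.log t) * hab

/-- A function that is a pointwise maximum of convex functions is convex. -/
lemma ConvexOn.of_forall_le_of_exists_eq {E ι : Type*} [AddCommGroup E] [Module ℝ E]
    {s : Set E} (hs : Convex ℝ s) {G : E → ℝ} {T : Set ι} {φ : ι → E → ℝ}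
    (hφ : ∀ i ∈ T, ConvexOn ℝ s (φ i)) (hle : ∀ i ∈ T, ∀ x ∈ s, φ i x ≤ G x)
    (heq : ∀ x ∈ s, ∃ i ∈ T, G x = φ i x) : ConvexOn ℝ s G := by
  refine ⟨hs, fun x hx y hy a b ha hb hab => ?_⟩
  obtain ⟨i, hi, h⟩ := heq _ (hs hx hy ha hb hab)
  rw [h]
  refine ((hφ i hi).2 hx hy ha hb hab).trans ?_
  simp only [smul_eq_mul]
  gcongr
  exacts [hle i hi x hx, hle i hi y hy]

/-- The integrand `B̂_♯(A) = (|A|²/det A + log(|A|²/(det A)²))/2` is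
polyconvex on `ℝ^{2×2}_+`: there is a convex `G : ℝ^{2×2} × (0,∞) → ℝ` with
`B̂_♯(A) = G(A, det A)` whenever `det A > 0`. -/
theorem stmt_18 :
    ∃ G : Matrix (Fin 2) (Fin 2) ℝ × ℝ → ℝ,
      ConvexOn ℝ ((Set.univ : Set (Matrix (Fin 2) (Fin 2) ℝ)) ×ˢ Set.Ioi (0 : ℝ)) G ∧
      ∀ A : Matrix (Fin 2) (Fin 2) ℝ, 0 < A.det →
        (opNorm A ^ 2 / A.det + Real.log (opNorm A ^ 2 / A.det ^ 2)) / 2 = G (A, A.det) := by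
  refine ⟨fun P => minorant (anticonformalNorm P.1) P.2
    (minorantArgmax (anticonformalNorm P.1) P.2), ?_, fun A hA => ?_⟩
  · refine ConvexOn.of_forall_le_of_exists_eq (convex_univ.prod (convex_Ioi 0)) (T := Set.Ioi 0)
      (φ := fun t P => minorant (anticonformalNorm P.1) P.2 t)
      (fun t ht => convexOn_minorant_anticonformalNorm (le_of_lt ht))
      (fun t ht P hP => minorant_le_of_critical hP.2 ht
        (minorantArgmax_pos (norm_nonneg _) hP.2) (minorantArgmax_spec hP.2))
      (fun P hP => ⟨_, minorantArgmax_pos (norm_nonneg _) hP.2, rfl⟩)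
  · have hσ : 0 ≤ conformalNorm A := norm_nonneg _
    have hβ : 0 ≤ anticonformalNorm A := norm_nonneg _
    have hsub := conformalNorm_sq_sub_anticonformalNorm_sq A
    have hsqrt : √(anticonformalNorm A ^ 2 + 4 * A.det) = conformalNorm A := by
      rw [← hsub, add_sub_cancel, Real.sqrt_sq hσ]
    have ht : minorantArgmax (anticonformalNorm A) A.det = opNorm A / A.det := by
      rw [minorantArgmax, hsqrt, opNorm_fin_two]
      field_simp
      ring
    have hcrit := minorantArgmax_spec (β := anticonformalNorm A) hA
    rw [ht] at hcrit
    have hdiv : opNorm A ^ 2 / A.det = A.det * (opNorm A / A.det) ^ 2 := by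
      field_simp
    simp only [ht, minorant]
    rw [← div_pow, Real.log_pow, hdiv]
    push_cast
    linear_combination hcrit
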